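/- arXiv:1703.03955 — 2 statements merged into one kernel-verified Lean document; each statement's English description precedes it below -/
import Mathlib

section
/- Let n ≥ 5 and W = S_{n+1}. Let I = R − {s_i} with 2 ≤ i ≤ n−1 and J = R − {s_1, s_j} with 2 < j < n−1. Then X⁺_{I,J}, with the restriction of the Bruhat order, is a lattice in which every element covers at most two elements and is covered by at most two elements (its Hasse diagram is a 'ladder'). -/
/-- The number of inversions (Coxeter length) of a permutation of `Fin m`. -/
def sLen {m : ℕ} (w : Equiv.Perm (Fin m)) : ℕ :=
  (Finset.univ.filter fun p : Fin m × Fin m => p.1 < p.2 ∧ w p.2 < w p.1).card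

/-- The Bruhat order on the symmetric group: generated by `w < t * w` for a
transposition `t` with `sLen (t * w) > sLen w`. -/
def bruhatLE {m : ℕ} (u v : Equiv.Perm (Fin m)) : Prop :=
  Relation.ReflTransGen
    (fun x y => (∃ a b : Fin m, a ≠ b ∧ y = Equiv.swap a b * x) ∧ sLen x < sLen y) u v

/-- The right descent set of `w`, as a set of indices of simple reflections:
`i : Fin n` stands for the simple transposition `s_{i+1} = (i+1, i+2)` (1-based). -/
def Des {n : ℕ} (w : Equiv.Perm (Fin (n + 1))) : Set (Fin n) :=
  {i | w i.succ < w i.castSucc}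

/-- Maximal-length double-coset representatives:
`X⁺_{I,J} = {w : I ⊆ Des (w⁻¹) ∧ J ⊆ Des w}`. -/
def Xplus {n : ℕ} (I J : Set (Fin n)) : Set (Equiv.Perm (Fin (n + 1))) :=
  {w | I ⊆ Des w⁻¹ ∧ J ⊆ Des w}

/-- A subset of the symmetric group is totally ordered (a chain) in Bruhat order. -/
def IsChainOn {m : ℕ} (X : Set (Equiv.Perm (Fin m))) : Prop :=
  ∀ x ∈ X, ∀ y ∈ X, bruhatLE x y ∨ bruhatLE y x

/-- A subset of the symmetric group, with the restriction of the Bruhat order,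
is a lattice: every pair has a least upper bound and a greatest lower bound in the set. -/
def IsLatticeOn {m : ℕ} (X : Set (Equiv.Perm (Fin m))) : Prop :=
  (∀ x ∈ X, ∀ y ∈ X, ∃ z ∈ X, bruhatLE x z ∧ bruhatLE y z ∧
      ∀ t ∈ X, bruhatLE x t → bruhatLE y t → bruhatLE z t) ∧
  (∀ x ∈ X, ∀ y ∈ X, ∃ z ∈ X, bruhatLE z x ∧ bruhatLE z y ∧
      ∀ t ∈ X, bruhatLE t x → bruhatLE t y → bruhatLE t z)

/-- `y` covers `x` in the restriction of the Bruhat order to `X`. -/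
def CoversIn {m : ℕ} (X : Set (Equiv.Perm (Fin m))) (x y : Equiv.Perm (Fin m)) : Prop :=
  x ∈ X ∧ y ∈ X ∧ bruhatLE x y ∧ x ≠ y ∧
    ∀ z ∈ X, bruhatLE x z → bruhatLE z y → z = x ∨ z = y

/-- The number of positions `k < p` with `w k < q`. -/
def rankCount {m : ℕ} (w : Equiv.Perm (Fin m)) (p q : ℕ) : ℕ :=
  (Finset.univ.filter fun k : Fin m => k.val < p ∧ (w k).val < q).card

section RankCount

variable {m : ℕ}

theorem rankCount_inv (w : Equiv.Perm (Fin m)) (p q : ℕ) :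
    rankCount w⁻¹ q p = rankCount w p q := by
  unfold rankCount
  refine Finset.card_bij (fun k _ => w⁻¹ k) ?_ ?_ ?_
  · intro k hk
    simp only [Finset.mem_filter, Finset.mem_univ, true_and] at hk ⊢
    simpa using hk.symm
  · intro a _ b _ h
    exact w⁻¹.injective h
  · intro k hk
    simp only [Finset.mem_filter, Finset.mem_univ, true_and] at hk
    exact ⟨w k, by simpa using hk.symm, by simp⟩

theorem rankCount_succ (w : Equiv.Perm (Fin m)) (k : Fin m) (q : ℕ) :
    rankCount w (k.val + 1) q = rankCount w k.val q + if (w k).val < q then 1 else 0 := by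
  unfold rankCount
  split_ifs with h
  · rw [← Finset.card_insert_of_notMem (a := k)]
    · congr 1
      ext x
      simp only [Finset.mem_filter, Finset.mem_univ, true_and, Finset.mem_insert]
      grind
    · simp
  · rw [add_zero]
    congr 1
    ext x
    simp only [Finset.mem_filter, Finset.mem_univ, true_and]
    grind

theorem rankCount_zero (w : Equiv.Perm (Fin m)) (q : ℕ) : rankCount w 0 q = 0 := by
  simp [rankCount]

theorem rankCount_of_le_right (w : Equiv.Perm (Fin m)) (p q : ℕ) (hq : m ≤ q) :
    rankCount w p q = (Finset.univ.filter fun k : Fin m => k.val < p).card := by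
  unfold rankCount
  congr 1
  ext x
  simp only [Finset.mem_filter, Finset.mem_univ, true_and]
  have := (w x).isLt
  omega

theorem rankCount_of_le_left (w : Equiv.Perm (Fin m)) (p q : ℕ) (hp : m ≤ p) :
    rankCount w p q = (Finset.univ.filter fun k : Fin m => k.val < q).card := by
  rw [← rankCount_inv, rankCount_of_le_right _ _ _ hp]

theorem rankCount_swap_mul (w : Equiv.Perm (Fin m)) (a b : Fin m) (p q : ℕ)
    (h : a.val < q ↔ b.val < q) :
    rankCount (Equiv.swap a b * w) p q = rankCount w p q := by
  unfold rankCount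
  congr 1
  ext x
  simp only [Finset.mem_filter, Finset.mem_univ, true_and, Equiv.Perm.mul_apply,
    Equiv.swap_apply_def]
  grind

theorem rankCount_mul_swap (w : Equiv.Perm (Fin m)) (a b : Fin m) (p q : ℕ)
    (h : a.val < p ↔ b.val < p) :
    rankCount (w * Equiv.swap a b) p q = rankCount w p q := by
  rw [← rankCount_inv, mul_inv_rev, Equiv.swap_inv, rankCount_swap_mul _ _ _ _ _ h,
    rankCount_inv]

theorem sLen_lt_sLen_mul_swap (w : Equiv.Perm (Fin m)) {k l : Fin m} (hkl : k < l)
    (hw : w k < w l) : sLen w < sLen (w * Equiv.swap k l) := by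
  unfold sLen
  let F : Fin m × Fin m → Fin m × Fin m := fun z =>
    if z.2 = k ∧ w z.1 < w l then (z.1, l)
    else if z.1 = l ∧ w k < w z.2 then (k, z.2) else z
  have hy : ∀ x, (w * Equiv.swap k l) x = if x = k then w l else if x = l then w k else w x := by
    intro x
    simp only [Equiv.Perm.mul_apply, Equiv.swap_apply_def]
    split_ifs <;> rfl
  have hinj : ∀ x y, w x = w y → x = y := fun x y h => w.injective h
  rw [← Finset.card_image_of_injOn (f := F)]
  · apply Finset.card_lt_card
    rw [Finset.ssubset_iff]
    refine ⟨(k, l), ?_, ?_⟩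
    · simp only [Finset.mem_image, Finset.mem_filter, Finset.mem_univ, true_and, F]
      grind
    · intro z hz
      simp only [Finset.mem_insert, Finset.mem_image, Finset.mem_filter, Finset.mem_univ,
        true_and] at hz ⊢
      simp only [hy]
      rcases hz with rfl | ⟨⟨x, y⟩, h, rfl⟩
      · grind
      · simp only [F]
        grind
  · rintro ⟨x, y⟩ h ⟨x', y'⟩ h' he
    simp only [Finset.coe_filter, Finset.mem_univ, true_and, Set.mem_ofPred_eq] at h h'
    simp only [F] at he
    grind

theorem mul_swap_eq_swap_mul (w : Equiv.Perm (Fin m)) (k l : Fin m) :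
    w * Equiv.swap k l = Equiv.swap (w k) (w l) * w := by
  rw [Equiv.mul_swap_eq_swap_mul]

theorem bruhatLE_mul_swap (w : Equiv.Perm (Fin m)) {k l : Fin m} (hkl : k < l)
    (hw : w k < w l) : bruhatLE w (w * Equiv.swap k l) :=
  Relation.ReflTransGen.single
    ⟨⟨w k, w l, hw.ne, mul_swap_eq_swap_mul w k l⟩, sLen_lt_sLen_mul_swap w hkl hw⟩

theorem rankCount_mul_swap_le (w : Equiv.Perm (Fin m)) {k l : Fin m} (hkl : k < l)
    (hw : w k < w l) (p q : ℕ) : rankCount (w * Equiv.swap k l) p q ≤ rankCount w p q := by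
  unfold rankCount
  have hy : ∀ x, (w * Equiv.swap k l) x = if x = k then w l else if x = l then w k else w x := by
    intro x
    simp only [Equiv.Perm.mul_apply, Equiv.swap_apply_def]
    split_ifs <;> rfl
  refine Finset.card_le_card_of_injOn
    (fun x => if x = l ∧ q ≤ (w l).val then k else x) ?_ ?_
  · intro x hx
    simp only [Finset.coe_filter, Finset.mem_univ, true_and, Set.mem_ofPred_eq, hy] at hx ⊢
    grind
  · intro x hx x' hx' he
    simp only [Finset.coe_filter, Finset.mem_univ, true_and, Set.mem_ofPred_eq, hy] at hx hx' he
    grind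

theorem rankCount_le_mul_swap_add_one (w : Equiv.Perm (Fin m)) {k l : Fin m}
    (hw : w k < w l) (p q : ℕ) :
    rankCount w p q ≤ rankCount (w * Equiv.swap k l) p q + 1 := by
  unfold rankCount
  refine le_trans (Finset.card_le_card ?_) (Finset.card_insert_le k _)
  intro x hx
  simp only [Finset.mem_filter, Finset.mem_univ, true_and, Finset.mem_insert,
    Equiv.Perm.mul_apply, Equiv.swap_apply_def] at hx ⊢
  grind

theorem rankCount_anti {u v : Equiv.Perm (Fin m)} (h : bruhatLE u v) (p q : ℕ) :
    rankCount v p q ≤ rankCount u p q := by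
  induction h with
  | refl => exact le_rfl
  | @tail x y _ hxy ih =>
    refine le_trans ?_ ih
    obtain ⟨⟨a, b, hab, rfl⟩, hlen⟩ := hxy
    wlog hlt : a < b generalizing a b
    · rw [Equiv.swap_comm] at hlen ⊢
      exact this b a hab.symm hlen (lt_of_le_of_ne (not_lt.1 hlt) hab.symm)
    have hxy : Equiv.swap a b * x = x * Equiv.swap (x⁻¹ a) (x⁻¹ b) := by
      rw [mul_swap_eq_swap_mul]; simp
    rw [hxy] at hlen ⊢
    rcases lt_trichotomy (x⁻¹ a) (x⁻¹ b) with h | h | h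
    · exact rankCount_mul_swap_le x h (by simpa using hlt) p q
    · exact absurd (x⁻¹.injective h) hab
    · have := sLen_lt_sLen_mul_swap (x * Equiv.swap (x⁻¹ a) (x⁻¹ b)) h (by simpa using hlt)
      rw [Equiv.swap_comm (x⁻¹ b), mul_assoc, Equiv.swap_mul_self, mul_one] at this
      omega

theorem exists_swap_of_rankCount_le {u v : Equiv.Perm (Fin m)} (huv : u ≠ v)
    (h : ∀ p q, rankCount v p q ≤ rankCount u p q) :
    ∃ k l : Fin m, k < l ∧ u k < u l ∧
      ∀ p q, rankCount v p q ≤ rankCount (u * Equiv.swap k l) p q := by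
  have hne : ∃ k, u k ≠ v k := by
    by_contra! hc
    exact huv (Equiv.ext hc)
  obtain ⟨k, hk, hkmin⟩ := WellFounded.has_min (wellFounded_lt (α := Fin m)) {k | u k ≠ v k} hne
  have hagree : ∀ x < k, u x = v x := fun x hx => by
    by_contra hc
    exact hkmin x hc hx
  simp only [Set.mem_ofPred_eq] at hk
  have hinju : ∀ x y, u x = u y → x = y := fun x y h => u.injective h
  have hinjv : ∀ x y, v x = v y → x = y := fun x y h => v.injective h
  have hkv : u k < v k := by
    by_contra hc
    have hlt := lt_of_le_of_ne (not_lt.1 hc) (Ne.symm hk)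
    have h1 := h (k.val + 1) ((v k).val + 1)
    rw [rankCount_succ, rankCount_succ] at h1
    have h2 : rankCount u k.val ((v k).val + 1) = rankCount v k.val ((v k).val + 1) := by
      unfold rankCount
      congr 1
      ext x
      simp only [Finset.mem_filter, Finset.mem_univ, true_and]
      grind
    grind
  have hex : ∃ l, k < l ∧ u k < u l ∧ u l ≤ v k := by
    refine ⟨u⁻¹ (v k), ?_, by simpa using hkv, by simp⟩
    have hu : u (u⁻¹ (v k)) = v k := by simp
    grind
  obtain ⟨l, ⟨hkl, hul, hlv⟩, hlmin⟩ :=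
    WellFounded.has_min (wellFounded_lt (α := Fin m)) {l | k < l ∧ u k < u l ∧ u l ≤ v k} hex
  have hgap : ∀ x, k < x → x < l → u k < u x → v k < u x := fun x h1 h2 h3 => by
    by_contra hc
    exact hlmin x ⟨h1, h3, not_lt.1 hc⟩ h2
  refine ⟨k, l, hkl, hul, fun p q => ?_⟩
  by_cases hp : k.val < p ↔ l.val < p
  · rw [rankCount_mul_swap _ _ _ _ _ hp]
    exact h p q
  by_cases hq : (u k).val < q ↔ (u l).val < q
  · rw [mul_swap_eq_swap_mul, rankCount_swap_mul _ _ _ _ _ hq]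
    exact h p q
  have hstep := rankCount_le_mul_swap_add_one u hul p q
  have hM := h p ((v k).val + 1)
  have hsplit : ∀ w : Equiv.Perm (Fin m), rankCount w p ((v k).val + 1) = rankCount w p q +
      (Finset.univ.filter fun x : Fin m =>
        x.val < p ∧ q ≤ (w x).val ∧ (w x).val < (v k).val + 1).card := by
    intro w
    unfold rankCount
    rw [← Finset.card_union_of_disjoint]
    · congr 1
      ext x
      simp only [Finset.mem_filter, Finset.mem_univ, true_and, Finset.mem_union]
      grind
    · rw [Finset.disjoint_left]
      intro x
      simp only [Finset.mem_filter, Finset.mem_univ, true_and]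
      grind
  rw [hsplit u, hsplit v] at hM
  have hlt : (Finset.univ.filter fun x : Fin m =>
        x.val < p ∧ q ≤ (u x).val ∧ (u x).val < (v k).val + 1).card <
      (Finset.univ.filter fun x : Fin m =>
        x.val < p ∧ q ≤ (v x).val ∧ (v x).val < (v k).val + 1).card := by
    apply Finset.card_lt_card
    rw [Finset.ssubset_iff]
    refine ⟨k, ?_, ?_⟩
    · simp only [Finset.mem_filter, Finset.mem_univ, true_and]
      grind
    · intro x hx
      simp only [Finset.mem_filter, Finset.mem_univ, true_and, Finset.mem_insert] at hx ⊢
      clear hsplit hlmin hkmin hM hstep h hex hne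
      rcases lt_trichotomy x k with hxk | rfl | hxk
      · have := hagree x hxk
        grind
      · grind
      · have := hgap x hxk
        grind
  omega

theorem sLen_le (w : Equiv.Perm (Fin m)) : sLen w ≤ m * m := by
  refine (Finset.card_le_univ _).trans ?_
  simp

/-- The rank criterion for the Bruhat order. -/
theorem bruhatLE_of_rankCount_le {u v : Equiv.Perm (Fin m)}
    (h : ∀ p q, rankCount v p q ≤ rankCount u p q) : bruhatLE u v := by
  induction hd : m * m - sLen u using Nat.strong_induction_on generalizing u with
  | _ d ih =>
    by_cases huv : u = v
    · subst huv
      exact Relation.ReflTransGen.refl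
    obtain ⟨k, l, hkl, hul, hr⟩ := exists_swap_of_rankCount_le huv h
    have h1 := sLen_lt_sLen_mul_swap u hkl hul
    have h2 := sLen_le (u * Equiv.swap k l)
    exact (bruhatLE_mul_swap u hkl hul).trans (ih _ (by omega) hr rfl)

/-- If `v` is decreasing on the block of positions `[a, b)`, the rank inequality on the block
follows from the one at its end points. -/
theorem rankCount_le_of_block {u v : Equiv.Perm (Fin m)} {a b q : ℕ} (hb : b ≤ m)
    (hdec : ∀ k l : Fin m, a ≤ k.val → l.val = k.val + 1 → l.val < b → v l < v k)
    (ha : rankCount v a q ≤ rankCount u a q) (hbq : rankCount v b q ≤ rankCount u b q)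
    {p : ℕ} (hap : a ≤ p) (hpb : p ≤ b) : rankCount v p q ≤ rankCount u p q := by
  have hanti : ∀ (k : Fin m) (d : ℕ) (hd : k.val + d < b), a ≤ k.val →
      v ⟨k.val + d, by omega⟩ ≤ v k := by
    intro k d hd hk
    induction d with
    | zero => exact le_rfl
    | succ d ih =>
      exact (hdec ⟨k.val + d, by omega⟩ ⟨k.val + (d + 1), by omega⟩
        (by simp only; omega) (by simp only; omega) hd).le.trans (ih (by omega))
  rcases hpb.eq_or_lt with rfl | hpb
  · exact hbq
  by_cases hv : (v ⟨p, by omega⟩).val < q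
  · have key : ∀ d, p + d ≤ b → rankCount v (p + d) q = rankCount v p q + d ∧
        rankCount u (p + d) q ≤ rankCount u p q + d := by
      intro d hd
      induction d with
      | zero => simp
      | succ d ih =>
        obtain ⟨h1, h2⟩ := ih (by omega)
        have hv' := rankCount_succ v ⟨p + d, by omega⟩ q
        have hu' := rankCount_succ u ⟨p + d, by omega⟩ q
        have hle := Fin.le_def.1 (hanti ⟨p, by omega⟩ d (by simp only; omega) hap)
        simp only at hv' hu' hle
        rw [if_pos (by omega)] at hv'
        rw [← add_assoc]
        split_ifs at hu' <;> omega
    have := key (b - p) (by omega)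
    rw [Nat.add_sub_cancel' hpb.le] at this
    omega
  · have key : ∀ d, a + d ≤ p → rankCount v (a + d) q = rankCount v a q ∧
        rankCount u a q ≤ rankCount u (a + d) q := by
      intro d hd
      induction d with
      | zero => simp
      | succ d ih =>
        obtain ⟨h1, h2⟩ := ih (by omega)
        have hv' := rankCount_succ v ⟨a + d, by omega⟩ q
        have hu' := rankCount_succ u ⟨a + d, by omega⟩ q
        have hle := Fin.le_def.1 (hanti ⟨a + d, by omega⟩ (p - (a + d)) (by simp only; omega)
          (by simp only; omega))
        simp only [show a + d + (p - (a + d)) = p by omega] at hv' hu' hle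
        rw [if_neg (by omega)] at hv'
        rw [← add_assoc]
        omega
    have := key (p - a) (by omega)
    rw [Nat.add_sub_cancel' hap] at this
    omega

/-- Maximality of `w` in its double coset for the value blocks `[0, i)`, `[i, m)` and the position
blocks `[0, 1)`, `[1, j)`, `[j, m)`. -/
def IsBlockDecreasing (i j : ℕ) (w : Equiv.Perm (Fin m)) : Prop :=
  (∀ k l : Fin m, l.val = k.val + 1 → l.val ≠ i → w⁻¹ l < w⁻¹ k) ∧
    ∀ k l : Fin m, l.val = k.val + 1 → l.val ≠ 1 → l.val ≠ j → w l < w k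

theorem IsBlockDecreasing.bruhatLE {i j : ℕ} (hi : i ≤ m) (hj1 : 1 ≤ j) (hj : j ≤ m)
    {u v : Equiv.Perm (Fin m)} (hv : IsBlockDecreasing i j v)
    (h1 : rankCount v 1 i ≤ rankCount u 1 i) (h2 : rankCount v j i ≤ rankCount u j i) :
    bruhatLE u v := by
  have hcol : ∀ p, rankCount v p i ≤ rankCount u p i := by
    intro p
    have hm : ∀ p, m ≤ p → rankCount v p i ≤ rankCount u p i := fun p hp => by
      rw [rankCount_of_le_left _ _ _ hp, rankCount_of_le_left _ _ _ hp]
    rcases le_total m p with hp | hp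
    · exact hm p hp
    rcases Nat.eq_zero_or_pos p with rfl | hp0
    · simp [rankCount_zero]
    rcases le_total p j with hpj | hpj
    · exact rankCount_le_of_block hj (fun k l hk hl hlj => hv.2 k l hl (by omega) (by omega))
        h1 h2 hp0 hpj
    · exact rankCount_le_of_block le_rfl
        (fun k l hk hl hlj => hv.2 k l hl (by omega) (by omega)) h2 (hm m le_rfl) hpj hp
  refine bruhatLE_of_rankCount_le fun p q => ?_
  have hm : ∀ q, m ≤ q → rankCount v p q ≤ rankCount u p q := fun q hq => by
    rw [rankCount_of_le_right _ _ _ hq, rankCount_of_le_right _ _ _ hq]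
  rcases le_total m q with hq | hq
  · exact hm q hq
  have hpi := hcol p
  have hpm := hm m le_rfl
  rw [← rankCount_inv v, ← rankCount_inv u] at hpi hpm ⊢
  rcases le_total q i with hqi | hqi
  · exact rankCount_le_of_block hi (fun k l _ hl hli => hv.1 k l hl (by omega))
      (by simp [rankCount_zero]) hpi (Nat.zero_le q) hqi
  · exact rankCount_le_of_block le_rfl (fun k l hk hl _ => hv.1 k l hl (by omega))
      hpi hpm hqi hq

theorem exists_isBlockDecreasing (i j : ℕ) (w : Equiv.Perm (Fin m)) :
    ∃ z : Equiv.Perm (Fin m), IsBlockDecreasing i j z ∧ rankCount z 1 i = rankCount w 1 i ∧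
      rankCount z j i = rankCount w j i := by
  classical
  obtain ⟨z, hz, hmax⟩ := Finset.exists_max_image
    (Finset.univ.filter fun z : Equiv.Perm (Fin m) =>
      rankCount z 1 i = rankCount w 1 i ∧ rankCount z j i = rankCount w j i) sLen ⟨w, by simp⟩
  simp only [Finset.mem_filter, Finset.mem_univ, true_and] at hz hmax
  refine ⟨z, ⟨fun k l hl hli => ?_, fun k l hl h1 hj => ?_⟩, hz⟩
  · by_contra hc
    have hkl : k < l := by rw [Fin.lt_def]; omega
    have hlt := lt_of_le_of_ne (not_lt.1 hc) (fun h => hkl.ne (z⁻¹.injective h))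
    have hlen := sLen_lt_sLen_mul_swap z hlt (by simpa using hkl)
    refine (hmax (z * Equiv.swap (z⁻¹ k) (z⁻¹ l)) ?_).not_gt hlen
    rw [mul_swap_eq_swap_mul]
    rw [show z (z⁻¹ k) = k by simp, show z (z⁻¹ l) = l by simp]
    rw [rankCount_swap_mul _ _ _ _ _ (by omega), rankCount_swap_mul _ _ _ _ _ (by omega)]
    exact hz
  · by_contra hc
    have hkl : k < l := by rw [Fin.lt_def]; omega
    have hlt := lt_of_le_of_ne (not_lt.1 hc) (fun h => hkl.ne (z.injective h))
    have hlen := sLen_lt_sLen_mul_swap z hkl hlt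
    refine (hmax (z * Equiv.swap k l) ?_).not_gt hlen
    rw [rankCount_mul_swap _ _ _ _ _ (by omega), rankCount_mul_swap _ _ _ _ _ (by omega)]
    exact hz

theorem rankCount_one (w : Equiv.Perm (Fin m)) (hm : 0 < m) (q : ℕ) :
    rankCount w 1 q = if (w ⟨0, hm⟩).val < q then 1 else 0 := by
  simpa [rankCount_zero] using rankCount_succ w ⟨0, hm⟩ q

/-- Two permutations whose corner ranks are incomparable give permutations realizing the
componentwise maximum and minimum of those ranks. -/
theorem exists_rankCount_of_incomparable {i j : ℕ} (hm : 0 < m) (hj1 : 1 ≤ j)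
    {x y : Equiv.Perm (Fin m)} (h1 : rankCount y 1 i < rankCount x 1 i)
    (h2 : rankCount x j i < rankCount y j i) :
    (∃ z : Equiv.Perm (Fin m), rankCount z 1 i = rankCount x 1 i ∧ rankCount z j i = rankCount y j i) ∧
    ∃ z : Equiv.Perm (Fin m), rankCount z 1 i = rankCount y 1 i ∧ rankCount z j i = rankCount x j i := by
  have hx1 := rankCount_one x hm i
  have hy1 := rankCount_one y hm i
  have hx0 : (x ⟨0, hm⟩).val < i := by
    by_contra hc
    simp [hc] at hx1
    omega
  have hy0 : ¬ (y ⟨0, hm⟩).val < i := by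
    intro hc
    simp only [hc, hx0, if_true] at hx1 hy1
    omega
  rw [if_pos hx0] at hx1
  rw [if_neg hy0] at hy1
  constructor
  · obtain ⟨k, hkj, hki⟩ : ∃ k : Fin m, k.val < j ∧ (y k).val < i := by
      have : 0 < rankCount y j i := by omega
      obtain ⟨k, hk⟩ := Finset.card_pos.1 this
      exact ⟨k, by simpa using hk⟩
    refine ⟨y * Equiv.swap ⟨0, hm⟩ k, ?_, rankCount_mul_swap _ _ _ _ _ (by simp only; omega)⟩
    rw [rankCount_one _ hm, hx1]
    simp [hki]
  · obtain ⟨k, hkj, hki⟩ : ∃ k : Fin m, k.val < j ∧ ¬ (x k).val < i := by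
      by_contra! hc
      refine h2.not_ge (Finset.card_le_card fun k hk => ?_)
      simp only [Finset.mem_filter, Finset.mem_univ, true_and] at hk ⊢
      exact ⟨hk.1, hc k hk.1⟩
    refine ⟨x * Equiv.swap ⟨0, hm⟩ k, ?_, rankCount_mul_swap _ _ _ _ _ (by simp only; omega)⟩
    rw [rankCount_one _ hm, hy1]
    simp [hki]

theorem isLatticeOn_isBlockDecreasing {i j : ℕ} (hm : 0 < m) (hi : i ≤ m) (hj1 : 1 ≤ j)
    (hj : j ≤ m) : IsLatticeOn {w : Equiv.Perm (Fin m) | IsBlockDecreasing i j w} := by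
  have hle : ∀ {u v : Equiv.Perm (Fin m)}, IsBlockDecreasing i j v →
      (bruhatLE u v ↔ rankCount v 1 i ≤ rankCount u 1 i ∧ rankCount v j i ≤ rankCount u j i) :=
    fun hv => ⟨fun h => ⟨rankCount_anti h 1 i, rankCount_anti h j i⟩,
      fun h => hv.bruhatLE hi hj1 hj h.1 h.2⟩
  have hbounds : ∀ x y : Equiv.Perm (Fin m),
      (∃ z : Equiv.Perm (Fin m), IsBlockDecreasing i j z ∧
        rankCount z 1 i = min (rankCount x 1 i) (rankCount y 1 i) ∧
        rankCount z j i = min (rankCount x j i) (rankCount y j i)) ∧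
      ∃ z : Equiv.Perm (Fin m), IsBlockDecreasing i j z ∧
        rankCount z 1 i = max (rankCount x 1 i) (rankCount y 1 i) ∧
        rankCount z j i = max (rankCount x j i) (rankCount y j i) := by
    intro x y
    suffices h : (∃ z : Equiv.Perm (Fin m),
        rankCount z 1 i = min (rankCount x 1 i) (rankCount y 1 i) ∧
        rankCount z j i = min (rankCount x j i) (rankCount y j i)) ∧
      ∃ z : Equiv.Perm (Fin m),
        rankCount z 1 i = max (rankCount x 1 i) (rankCount y 1 i) ∧
        rankCount z j i = max (rankCount x j i) (rankCount y j i) by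
      obtain ⟨⟨z, hz1, hz2⟩, z', hz1', hz2'⟩ := h
      obtain ⟨t, ht, ht1, ht2⟩ := exists_isBlockDecreasing i j z
      obtain ⟨t', ht', ht1', ht2'⟩ := exists_isBlockDecreasing i j z'
      exact ⟨⟨t, ht, by omega, by omega⟩, t', ht', by omega, by omega⟩
    rcases le_or_gt (rankCount x 1 i) (rankCount y 1 i) with h1 | h1 <;>
      rcases le_or_gt (rankCount x j i) (rankCount y j i) with h2 | h2
    · exact ⟨⟨x, by omega, by omega⟩, y, by omega, by omega⟩
    · rcases h1.eq_or_lt with h1 | h1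
      · exact ⟨⟨y, by omega, by omega⟩, x, by omega, by omega⟩
      obtain ⟨⟨z, hz⟩, z', hz'⟩ := exists_rankCount_of_incomparable hm hj1 h1 h2
      exact ⟨⟨z', by omega, by omega⟩, z, by omega, by omega⟩
    · rcases h2.eq_or_lt with h2 | h2
      · exact ⟨⟨y, by omega, by omega⟩, x, by omega, by omega⟩
      obtain ⟨⟨z, hz⟩, z', hz'⟩ := exists_rankCount_of_incomparable hm hj1 h1 h2
      exact ⟨⟨z', by omega, by omega⟩, z, by omega, by omega⟩
    · exact ⟨⟨y, by omega, by omega⟩, x, by omega, by omega⟩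
  refine ⟨fun x hx y hy => ?_, fun x hx y hy => ?_⟩
  · obtain ⟨z, hz, h1, h2⟩ := (hbounds x y).1
    refine ⟨z, hz, (hle hz).2 (by omega), (hle hz).2 (by omega), fun t ht hxt hyt => ?_⟩
    have := (hle ht).1 hxt
    have := (hle ht).1 hyt
    exact (hle ht).2 (by omega)
  · obtain ⟨z, hz, h1, h2⟩ := (hbounds x y).2
    refine ⟨z, hz, (hle hx).2 (by omega), (hle hy).2 (by omega), fun t ht htx hty => ?_⟩
    have := (hle hx).1 htx
    have := (hle hy).1 hty
    exact (hle hz).2 (by omega)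

theorem IsBlockDecreasing.bruhatLE_total {i j : ℕ} (hi : i ≤ m) (hj1 : 1 ≤ j) (hj : j ≤ m)
    {u v : Equiv.Perm (Fin m)} (hu : IsBlockDecreasing i j u) (hv : IsBlockDecreasing i j v)
    (h : rankCount u 1 i = rankCount v 1 i) : _root_.bruhatLE u v ∨ _root_.bruhatLE v u :=
  (le_total (rankCount v j i) (rankCount u j i)).imp
    (hv.bruhatLE hi hj1 hj h.ge) (hu.bruhatLE hi hj1 hj h.le)

theorem CoversIn.eq_of_bruhatLE_total {X : Set (Equiv.Perm (Fin m))} {x a b : Equiv.Perm (Fin m)}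
    (ha : CoversIn X x a) (hb : CoversIn X x b) (h : bruhatLE a b ∨ bruhatLE b a) : a = b := by
  obtain ⟨-, haX, hxa, hne, hca⟩ := ha
  obtain ⟨-, hbX, hxb, hne', hcb⟩ := hb
  rcases h with h | h
  · exact (hcb a haX hxa h).resolve_left hne.symm
  · exact ((hca b hbX hxb h).resolve_left hne'.symm).symm

theorem CoversIn.eq_of_bruhatLE_total' {X : Set (Equiv.Perm (Fin m))} {x a b : Equiv.Perm (Fin m)}
    (ha : CoversIn X a x) (hb : CoversIn X b x) (h : bruhatLE a b ∨ bruhatLE b a) : a = b := by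
  obtain ⟨haX, -, hxa, hne, hca⟩ := ha
  obtain ⟨hbX, -, hxb, hne', hcb⟩ := hb
  rcases h with h | h
  · exact ((hca b hbX h hxb).resolve_right hne').symm
  · exact (hcb a haX h hxa).resolve_right hne

end RankCount

theorem Xplus_eq_isBlockDecreasing {n i j : ℕ} (hi0 : 1 ≤ i) (hi : i ≤ n) (hj0 : 1 ≤ j)
    (hj : j ≤ n) :
    Xplus (({⟨i - 1, by omega⟩} : Set (Fin n))ᶜ)
      (({⟨0, by omega⟩, ⟨j - 1, by omega⟩} : Set (Fin n))ᶜ) = {w | IsBlockDecreasing i j w} := by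
  ext w
  have hdes : ∀ (v : Equiv.Perm (Fin (n + 1))) (K : Set (Fin n)), K ⊆ Des v ↔
      ∀ k l : Fin (n + 1), (hl : l.val = k.val + 1) → (⟨k.val, by omega⟩ : Fin n) ∈ K →
        v l < v k := by
    intro v K
    constructor
    · intro h k l hl hk
      have he : l = Fin.succ ⟨k.val, by omega⟩ := Fin.ext hl
      rw [he]
      exact h hk
    · intro h k hk
      exact h k.castSucc k.succ (by simp) hk
  simp only [Xplus, Set.mem_ofPred_eq, hdes, IsBlockDecreasing, Set.mem_compl_iff,
    Set.mem_insert_iff, Set.mem_singleton_iff, Fin.mk.injEq, not_or, and_imp]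
  constructor
  · rintro ⟨h1, h2⟩
    exact ⟨fun k l hl h => h1 k l hl (by omega),
      fun k l hl h h' => h2 k l hl (by omega) (by omega)⟩
  · rintro ⟨h1, h2⟩
    exact ⟨fun k l hl h => h1 k l hl (by omega),
      fun k l hl h h' => h2 k l hl (by omega) (by omega)⟩

/-- Let `n ≥ 5`, `I = R − {s_i}` with `2 ≤ i ≤ n−1`, and `J = R − {s_1, s_j}` with
`2 < j < n−1` (all 1-based).  Then `X⁺_{I,J}`, with the restriction of the Bruhat
order, is a lattice in which every element covers at most two elements and is
covered by at most two elements (a "ladder"). -/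
theorem stmt_15 (n : ℕ) (hn : 5 ≤ n) (i j : ℕ)
    (hi1 : 2 ≤ i) (hi2 : i ≤ n - 1) (hj1 : 2 < j) (hj2 : j < n - 1)
    (I J : Set (Fin n))
    (hI : I = ({⟨i - 1, by omega⟩} : Set (Fin n))ᶜ)
    (hJ : J = ({⟨0, by omega⟩, ⟨j - 1, by omega⟩} : Set (Fin n))ᶜ) :
    IsLatticeOn (Xplus I J) ∧
    (∀ x ∈ Xplus I J, ∀ a b c : Equiv.Perm (Fin (n + 1)),
      CoversIn (Xplus I J) x a → CoversIn (Xplus I J) x b → CoversIn (Xplus I J) x c →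
        a = b ∨ a = c ∨ b = c) ∧
    (∀ x ∈ Xplus I J, ∀ a b c : Equiv.Perm (Fin (n + 1)),
      CoversIn (Xplus I J) a x → CoversIn (Xplus I J) b x → CoversIn (Xplus I J) c x →
        a = b ∨ a = c ∨ b = c) := by
  subst hI hJ
  rw [Xplus_eq_isBlockDecreasing (by omega) (by omega) (by omega) (by omega)]
  have hfib : ∀ a b c : Equiv.Perm (Fin (n + 1)),
      rankCount a 1 i = rankCount b 1 i ∨ rankCount a 1 i = rankCount c 1 i ∨
        rankCount b 1 i = rankCount c 1 i := by
    intro a b c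
    simp only [rankCount_one _ n.succ_pos]
    split_ifs <;> simp
  have htot : ∀ {a b : Equiv.Perm (Fin (n + 1))}, IsBlockDecreasing i j a →
      IsBlockDecreasing i j b → rankCount a 1 i = rankCount b 1 i →
      bruhatLE a b ∨ bruhatLE b a :=
    fun ha hb => ha.bruhatLE_total (by omega) (by omega) (by omega) hb
  refine ⟨isLatticeOn_isBlockDecreasing n.succ_pos (by omega) (by omega) (by omega),
    fun x _ a b c ha hb hc => ?_, fun x _ a b c ha hb hc => ?_⟩
  · exact (hfib a b c).imp (fun h => ha.eq_of_bruhatLE_total hb (htot ha.2.1 hb.2.1 h))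
      (Or.imp (fun h => ha.eq_of_bruhatLE_total hc (htot ha.2.1 hc.2.1 h))
        (fun h => hb.eq_of_bruhatLE_total hc (htot hb.2.1 hc.2.1 h)))
  · exact (hfib a b c).imp (fun h => ha.eq_of_bruhatLE_total' hb (htot ha.1 hb.1 h))
      (Or.imp (fun h => ha.eq_of_bruhatLE_total' hc (htot ha.1 hc.1 h))
        (fun h => hb.eq_of_bruhatLE_total' hc (htot hb.1 hc.1 h)))
end

section
/- Let n ≥ 1 and W = S_{n+1}, acting on ℝ^{n+1} by permuting coordinates: (w·μ)_k = μ_{w⁻¹(k)}. Let θ ∈ ℝ^{n+1} be dominant (θ_1 ≥ ⋯ ≥ θ_{n+1}), let J = {s_k ∈ R : θ_k = θ_{k+1}}, so that the subgroup W_J generated by J is the stabilizer of θ, and let I ⊆ R. Let (Wθ)_I = {μ ∈ Wθ : μ_a ≥ μ_{a+1} for all a with s_a ∈ I}, and define a partial order ≤_B on (Wθ)_I as the transitive closure of the relations μ <_B t·μ for transpositions t = (a b) with a < b, μ_a > μ_b, and t·μ ∈ (Wθ)_I. Then the evaluation map w ↦ w·θ is an order isomorphism from X⁻_{I,J} with the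 restriction of the Bruhat order onto ((Wθ)_I, ≤_B). -/
/-- The action of `S_m` on `ℝ^m` by permuting coordinates: `(w·μ)_k = μ_{w⁻¹(k)}`. -/
def act {m : ℕ} (w : Equiv.Perm (Fin m)) (μ : Fin m → ℝ) : Fin m → ℝ :=
  fun k => μ (w⁻¹ k)

/-- Minimal-length double-coset representatives:
`X⁻_{I,J} = {w : I ⊆ Asc (w⁻¹) ∧ J ⊆ Asc w}`, where `Asc w = R − Des w`. -/
def Xminus {n : ℕ} (I J : Set (Fin n)) : Set (Equiv.Perm (Fin (n + 1))) :=
  {w | I ⊆ (Des w⁻¹)ᶜ ∧ J ⊆ (Des w)ᶜ}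

/-- `μ` is weakly decreasing on the fibres of `blk`. -/
def BlockAntitone {m : ℕ} {β : Type*} (blk : Fin m → β) (μ : Fin m → ℝ) : Prop :=
  ∀ i j, i ≤ j → blk i = blk j → μ j ≤ μ i

/-- A transposition moving a larger coordinate to the right, with target in the orbit of `θ`
and weakly decreasing on the fibres of `blk`. -/
def BlockStep {m : ℕ} {β : Type*} (blk : Fin m → β) (θ μ ν : Fin m → ℝ) : Prop :=
  (∃ a b : Fin m, a < b ∧ μ b < μ a ∧ ν = act (Equiv.swap a b) μ) ∧
    (∃ w : Equiv.Perm (Fin m), ν = act w θ) ∧ BlockAntitone blk ν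

theorem act_swap {m : ℕ} (a b : Fin m) (μ : Fin m → ℝ) :
    act (Equiv.swap a b) μ = μ ∘ Equiv.swap a b := by
  funext k
  simp [act]

theorem perm_apply_inv_apply {α : Type*} (w : Equiv.Perm α) (k : α) : w (w⁻¹ k) = k :=
  Equiv.apply_symm_apply w k

theorem sLen_lt_sLen_mul_swap_s19 {m : ℕ} (x : Equiv.Perm (Fin m)) {a b : Fin m} (hab : a < b)
    (hx : x a < x b) : sLen x < sLen (x * Equiv.swap a b) := by
  classical
  set s := Equiv.swap a b with hs
  have hss : ∀ i, s (s i) = i := fun i => Equiv.swap_apply_self a b i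
  have hsa : s a = b := Equiv.swap_apply_left a b
  have hsb : s b = a := Equiv.swap_apply_right a b
  have hso : ∀ i, i ≠ a → i ≠ b → s i = i := fun i => Equiv.swap_apply_of_ne_of_ne
  let f : Fin m × Fin m → Fin m × Fin m := fun p =>
    if s p.1 < s p.2 then (s p.1, s p.2) else p
  unfold sLen
  rw [← Finset.card_image_of_injOn (f := f)]
  · apply Finset.card_lt_card
    rw [Finset.ssubset_iff_of_subset]
    · refine ⟨(a, b), Finset.mem_filter.2 ⟨Finset.mem_univ _, hab, ?_⟩, ?_⟩
      · simpa [hsa, hsb] using hx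
      simp only [Finset.mem_image, Finset.mem_filter, Finset.mem_univ, true_and, not_exists,
        not_and, Prod.forall]
      intro i j ⟨hij, hx'⟩ hf
      simp only [f] at hf
      split_ifs at hf with h
      · simp only [Prod.mk.injEq] at hf
        have h1 := hss i
        have h2 := hss j
        rw [hf.1, hsa] at h1
        rw [hf.2, hsb] at h2
        subst h1 h2
        exact absurd hij hab.asymm
      · simp only [Prod.mk.injEq] at hf
        rw [hf.1, hf.2] at hx'
        exact absurd hx hx'.asymm
    · intro p hp
      simp only [Finset.mem_image, Finset.mem_filter, Finset.mem_univ, true_and, Prod.exists] at hp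
      obtain ⟨i, j, ⟨hij, hx'⟩, rfl⟩ := hp
      simp only [f]
      split_ifs with h
      · refine Finset.mem_filter.2 ⟨Finset.mem_univ _, h, ?_⟩
        simpa [hss] using hx'
      · refine Finset.mem_filter.2 ⟨Finset.mem_univ _, hij, ?_⟩
        simp only [Equiv.Perm.mul_apply]
        by_cases hia : i = a
        · subst hia
          by_cases hjb : j = b
          · subst hjb
            exact absurd hx hx'.asymm
          · rw [hso j hij.ne' hjb, hsa]
            exact hx'.trans hx
        · by_cases hib : i = b
          · subst hib
            rw [hsb, hso j (hab.trans hij).ne' hij.ne'] at h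
            exact absurd (hab.trans hij) h
          · rw [hso i hia hib] at h ⊢
            by_cases hjb : j = b
            · subst hjb
              rw [hsb]
              exact hx.trans hx'
            · by_cases hja : j = a
              · subst hja
                rw [hsa] at h
                exact absurd (hij.trans hab) h
              · rw [hso j hja hjb] at h
                exact absurd hij h
  · rintro ⟨i, j⟩ hp ⟨i', j'⟩ hq hf
    simp only [Finset.coe_filter, Finset.mem_univ, true_and, Set.mem_ofPred_eq] at hp hq
    simp only [f] at hf
    split_ifs at hf with h h' h'
    · simpa using hf
    · simp only [Prod.mk.injEq] at hf
      rw [← hf.1, ← hf.2, hss, hss] at h'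
      exact absurd hp.1 h'
    · simp only [Prod.mk.injEq] at hf
      rw [hf.1, hf.2, hss, hss] at h
      exact absurd hq.1 h
    · exact hf

theorem inv_lt_inv_of_sLen_lt {m : ℕ} (x : Equiv.Perm (Fin m)) {a b : Fin m} (hab : a < b)
    (h : sLen x < sLen (Equiv.swap a b * x)) : x⁻¹ a < x⁻¹ b := by
  by_contra hc
  have hlt : x⁻¹ b < x⁻¹ a :=
    lt_of_le_of_ne (not_lt.1 hc) fun he => hab.ne' (x⁻¹.injective he)
  have := sLen_lt_sLen_mul_swap_s19 (Equiv.swap a b * x) hlt (by simpa using hab)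
  rw [mul_assoc, Equiv.mul_swap_eq_swap_mul] at this
  rw [perm_apply_inv_apply, perm_apply_inv_apply, Equiv.swap_comm b a,
    Equiv.swap_mul_self_mul] at this
  exact absurd h this.asymm

theorem swap_mul_swap_eq_left {α : Type*} [DecidableEq α] {a b c : α} (hab : a ≠ b) (hca : c ≠ a)
    (hcb : c ≠ b) : Equiv.swap a b = Equiv.swap c b * Equiv.swap a b * Equiv.swap a c := by
  ext i
  simp only [Equiv.Perm.mul_apply, Equiv.swap_apply_def]
  grind

theorem swap_mul_swap_eq_right {α : Type*} [DecidableEq α] {a b c : α} (hab : a ≠ b)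
    (hca : c ≠ a) (hcb : c ≠ b) :
    Equiv.swap a b = Equiv.swap a c * Equiv.swap a b * Equiv.swap b c := by
  ext i
  simp only [Equiv.Perm.mul_apply, Equiv.swap_apply_def]
  grind

section Blocks

variable {m : ℕ} {β : Type*} {blk : Fin m → β}

/-- Swapping the last occurrence of a value with the first occurrence of the next smaller one
keeps both blocks weakly decreasing. -/
theorem BlockAntitone.comp_swap {μ : Fin m → ℝ} (hμ : BlockAntitone blk μ) {a b : Fin m}
    (hab : blk a ≠ blk b) (hlt : μ b < μ a)
    (hgap : ∀ c, blk c = blk a ∨ blk c = blk b → ¬(μ b < μ c ∧ μ c < μ a))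
    (ha : ∀ c, a < c → blk c = blk a → μ c ≠ μ a)
    (hb : ∀ c, c < b → blk c = blk b → μ c ≠ μ b) :
    BlockAntitone blk (μ ∘ Equiv.swap a b) := by
  intro i j hij h
  rcases hij.eq_or_lt with rfl | hij'
  · exact le_rfl
  simp only [Function.comp_apply]
  by_cases hia : i = a
  · subst hia
    have hjb : j ≠ b := by rintro rfl; exact hab h
    rw [Equiv.swap_apply_left, Equiv.swap_apply_of_ne_of_ne hij'.ne' hjb]
    have h1 := lt_of_le_of_ne (hμ i j hij h) (ha j hij' h.symm)
    by_contra hc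
    exact hgap j (Or.inl h.symm) ⟨not_le.1 hc, h1⟩
  by_cases hib : i = b
  · subst hib
    have hja : j ≠ a := by rintro rfl; exact hab h.symm
    rw [Equiv.swap_apply_right, Equiv.swap_apply_of_ne_of_ne hja hij'.ne']
    exact (hμ i j hij h).trans hlt.le
  rw [Equiv.swap_apply_of_ne_of_ne hia hib]
  by_cases hja : j = a
  · subst hja
    rw [Equiv.swap_apply_left]
    exact hlt.le.trans (hμ i j hij h)
  by_cases hjb : j = b
  · subst hjb
    rw [Equiv.swap_apply_right]
    have h1 := lt_of_le_of_ne (hμ i j hij h) (hb i hij' h).symm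
    by_contra hc
    exact hgap i (Or.inr h) ⟨h1, not_le.1 hc⟩
  rw [Equiv.swap_apply_of_ne_of_ne hja hjb]
  exact hμ i j hij h

theorem blk_swap {a b : Fin m} (h : blk a = blk b) (i : Fin m) :
    blk (Equiv.swap a b i) = blk i := by
  rw [Equiv.swap_apply_def]
  split_ifs with h1 h2
  · rw [h1, h]
  · rw [h2, h]
  · rfl

theorem blk_inv {z : Equiv.Perm (Fin m)} (hz : ∀ i, blk (z i) = blk i) (i : Fin m) :
    blk (z⁻¹ i) = blk i := by
  rw [← hz (z⁻¹ i), perm_apply_inv_apply]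

variable [LinearOrder β]

theorem monotone_toLex_of_blockAntitone (hb : Monotone blk) {μ : Fin m → ℝ}
    (hμ : BlockAntitone blk μ) : Monotone fun i => toLex (blk i, OrderDual.toDual (μ i)) := by
  intro i j hij
  rw [Prod.Lex.toLex_le_toLex]
  rcases (hb hij).lt_or_eq with h | h
  · exact Or.inl h
  · exact Or.inr ⟨h, hμ i j hij h⟩

/-- A function weakly decreasing on blocks is determined by its contents on each block. -/
theorem BlockAntitone.eq_of_comp (hb : Monotone blk) {μ ν : Fin m → ℝ}
    (hμ : BlockAntitone blk μ) (hν : BlockAntitone blk ν) (z : Equiv.Perm (Fin m))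
    (hz : ∀ i, blk (z i) = blk i) (h : ν = μ ∘ z) : ν = μ := by
  have h1 := monotone_toLex_of_blockAntitone hb hμ
  have h2 := monotone_toLex_of_blockAntitone hb hν
  have := Tuple.unique_monotone (f := fun i => toLex (blk i, OrderDual.toDual (μ i)))
    (σ := z) (τ := 1) (by simpa [Function.comp_def, hz, h] using h2) h1
  funext i
  have hi := congrFun this i
  simp only [Function.comp_apply, Equiv.Perm.one_apply, EmbeddingLike.apply_eq_iff_eq,
    Prod.mk.injEq] at hi
  rw [h]
  exact hi.2

theorem exists_blockAntitone_comp (hb : Monotone blk) (μ : Fin m → ℝ) :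
    ∃ z : Equiv.Perm (Fin m), (∀ i, blk (z i) = blk i) ∧ BlockAntitone blk (μ ∘ z) := by
  let f : Fin m → β ×ₗ ℝᵒᵈ := fun i => toLex (blk i, OrderDual.toDual (μ i))
  have hs : Monotone (f ∘ Tuple.sort f) := Tuple.monotone_sort f
  have hmono : Monotone (blk ∘ Tuple.sort f) := by
    intro i j hij
    have := hs hij
    simp only [f, Function.comp_apply, Prod.Lex.toLex_le_toLex] at this
    rcases this with h | h
    · exact h.le
    · exact h.1.le
  have heq : blk ∘ Tuple.sort f = blk ∘ (1 : Equiv.Perm (Fin m)) :=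
    Tuple.unique_monotone hmono hb
  have hz : ∀ i, blk (Tuple.sort f i) = blk i := fun i => congrFun heq i
  refine ⟨Tuple.sort f, hz, fun i j hij h => ?_⟩
  have := hs hij
  simp only [f, Function.comp_apply, Prod.Lex.toLex_le_toLex, hz, h, lt_irrefl, true_and,
    false_or] at this
  exact this

/-- Moving a larger coordinate to a later block and re-sorting the blocks can be achieved by
transpositions that stay among block-antitone functions. -/
theorem reflTransGen_blockStep (hb : Monotone blk) {θ μ ν : Fin m → ℝ} {a b : Fin m}
    (hθ : ∃ w : Equiv.Perm (Fin m), μ = act w θ) (hμ : BlockAntitone blk μ)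
    (hν : BlockAntitone blk ν) (hab : blk a ≤ blk b) (hlt : μ b < μ a)
    (z : Equiv.Perm (Fin m)) (hz : ∀ i, blk (z i) = blk i) (h : ν = μ ∘ Equiv.swap a b ∘ z) :
    Relation.ReflTransGen (BlockStep blk θ) μ ν := by
  classical
  induction hN : ((Finset.univ.image θ).filter fun s => μ b < s ∧ s < μ a).card using
    Nat.strong_induction_on generalizing μ ν a b z with
  | _ N ih =>
  subst hN
  have horb : ∀ (w : Equiv.Perm (Fin m)) {κ}, (∃ w : Equiv.Perm (Fin m), κ = act w θ) →
      ∃ w' : Equiv.Perm (Fin m), κ ∘ w = act w' θ := by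
    rintro w _ ⟨w', rfl⟩
    exact ⟨w⁻¹ * w', by funext k; simp [act]⟩
  have hmem : ∀ c, μ c ∈ Finset.univ.image θ := by
    obtain ⟨w, rfl⟩ := hθ
    exact fun c => Finset.mem_image_of_mem _ (Finset.mem_univ _)
  have hcard : ∀ c y x, μ b ≤ y → x ≤ μ a → μ b < μ c → μ c < μ a → ¬(y < μ c ∧ μ c < x) →
      ((Finset.univ.image θ).filter fun s => y < s ∧ s < x).card <
      ((Finset.univ.image θ).filter fun s => μ b < s ∧ s < μ a).card := by
    intro c y x hy hx h1 h2 h3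
    apply Finset.card_lt_card
    rw [Finset.ssubset_iff_of_subset]
    · exact ⟨μ c, by simp only [Finset.mem_filter, hmem, h1, h2, and_self],
        by simp only [Finset.mem_filter, h3, and_false, not_false_eq_true]⟩
    · intro s hs
      simp only [Finset.mem_filter] at hs ⊢
      exact ⟨hs.1, hy.trans_lt hs.2.1, hs.2.2.trans_le hx⟩
  rcases hab.eq_or_lt with hab | hab
  · rw [BlockAntitone.eq_of_comp hb hμ hν (Equiv.swap a b * z)
      (fun i => by rw [Equiv.Perm.mul_apply, blk_swap hab, hz]) h]
  have hne : a ≠ b := by rintro rfl; exact hab.ne rfl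
  by_cases hA : ∃ c, blk c = blk a ∧ μ b < μ c ∧ μ c < μ a
  · obtain ⟨c, hc, hbc, hca⟩ := hA
    obtain ⟨z₁, hz₁, hd⟩ := exists_blockAntitone_comp hb (μ ∘ Equiv.swap c b)
    have hca' : c ≠ a := by rintro rfl; exact hca.ne rfl
    have hcb' : c ≠ b := by rintro rfl; exact hbc.ne rfl
    have hsa : Equiv.swap c b a = a := Equiv.swap_apply_of_ne_of_ne hca'.symm hne
    refine (ih _ (hcard c _ _ le_rfl hca.le hbc hca fun h => h.2.ne rfl) hθ hμ hd
      (hc.trans_le hab.le) hbc z₁ hz₁ rfl rfl).trans ?_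
    have hva : ((μ ∘ Equiv.swap c b) ∘ z₁) (z₁⁻¹ a) = μ a := by simp [hsa]
    have hvb : ((μ ∘ Equiv.swap c b) ∘ z₁) (z₁⁻¹ b) = μ c := by simp
    refine ih _ ?_ (horb _ (horb _ hθ)) hd hν (a := z₁⁻¹ a) (b := z₁⁻¹ b) ?_ ?_
      (z₁⁻¹ * Equiv.swap a c * z) ?_ ?_ rfl
    · rw [hva, hvb]
      exact hcard c _ _ hbc.le le_rfl hbc hca fun h => h.1.ne rfl
    · rw [blk_inv hz₁, blk_inv hz₁]
      exact hab.le
    · rw [hva, hvb]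
      exact hca
    · intro i
      rw [Equiv.Perm.mul_apply, Equiv.Perm.mul_apply, blk_inv hz₁, blk_swap hc.symm, hz]
    · have : Equiv.swap a b * z = Equiv.swap c b * z₁ * Equiv.swap (z₁⁻¹ a) (z₁⁻¹ b) *
          (z₁⁻¹ * Equiv.swap a c * z) := by
        rw [mul_assoc (Equiv.swap c b), Equiv.mul_swap_eq_swap_mul, perm_apply_inv_apply,
          perm_apply_inv_apply]
        conv_lhs => rw [swap_mul_swap_eq_left hne hca' hcb']
        group
      rw [h]
      exact congrArg (fun g : Equiv.Perm (Fin m) => μ ∘ g) this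
  by_cases hB : ∃ c, blk c = blk b ∧ μ b < μ c ∧ μ c < μ a
  · obtain ⟨c, hc, hbc, hca⟩ := hB
    obtain ⟨z₁, hz₁, hd⟩ := exists_blockAntitone_comp hb (μ ∘ Equiv.swap a c)
    have hca' : c ≠ a := by rintro rfl; exact hca.ne rfl
    have hcb' : c ≠ b := by rintro rfl; exact hbc.ne rfl
    have hsb : Equiv.swap a c b = b := Equiv.swap_apply_of_ne_of_ne hne.symm hcb'.symm
    refine (ih _ (hcard c _ _ hbc.le le_rfl hbc hca fun h => h.1.ne rfl) hθ hμ hd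
      (hab.le.trans_eq hc.symm) hca z₁ hz₁ rfl rfl).trans ?_
    have hva : ((μ ∘ Equiv.swap a c) ∘ z₁) (z₁⁻¹ a) = μ c := by simp
    have hvb : ((μ ∘ Equiv.swap a c) ∘ z₁) (z₁⁻¹ b) = μ b := by simp [hsb]
    refine ih _ ?_ (horb _ (horb _ hθ)) hd hν (a := z₁⁻¹ a) (b := z₁⁻¹ b) ?_ ?_
      (z₁⁻¹ * Equiv.swap b c * z) ?_ ?_ rfl
    · rw [hva, hvb]
      exact hcard c _ _ le_rfl hca.le hbc hca fun h => h.2.ne rfl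
    · rw [blk_inv hz₁, blk_inv hz₁]
      exact hab.le
    · rw [hva, hvb]
      exact hbc
    · intro i
      rw [Equiv.Perm.mul_apply, Equiv.Perm.mul_apply, blk_inv hz₁, blk_swap hc.symm, hz]
    · have : Equiv.swap a b * z = Equiv.swap a c * z₁ * Equiv.swap (z₁⁻¹ a) (z₁⁻¹ b) *
          (z₁⁻¹ * Equiv.swap b c * z) := by
        rw [mul_assoc (Equiv.swap a c), Equiv.mul_swap_eq_swap_mul, perm_apply_inv_apply,
          perm_apply_inv_apply]
        conv_lhs => rw [swap_mul_swap_eq_right hne hca' hcb']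
        group
      rw [h]
      exact congrArg (fun g : Equiv.Perm (Fin m) => μ ∘ g) this
  obtain ⟨a', ha', hmax⟩ := Finset.exists_max_image
    (Finset.univ.filter fun c => blk c = blk a ∧ μ c = μ a) id ⟨a, by simp⟩
  obtain ⟨b', hb', hmin⟩ := Finset.exists_min_image
    (Finset.univ.filter fun c => blk c = blk b ∧ μ c = μ b) id ⟨b, by simp⟩
  simp only [Finset.mem_filter, Finset.mem_univ, true_and, id_eq, and_imp] at ha' hb' hmax hmin
  have hd : BlockAntitone blk (μ ∘ Equiv.swap a' b') := by
    apply hμ.comp_swap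
    · rw [ha'.1, hb'.1]
      exact hab.ne
    · rw [ha'.2, hb'.2]
      exact hlt
    · rw [ha'.1, hb'.1, ha'.2, hb'.2]
      rintro c (hc | hc) h
      exacts [hA ⟨c, hc, h⟩, hB ⟨c, hc, h⟩]
    · intro c h1 h2 h3
      exact h1.not_ge (hmax c (h2.trans ha'.1) (h3.trans ha'.2))
    · intro c h1 h2 h3
      exact h1.not_ge (hmin c (h2.trans hb'.1) (h3.trans hb'.2))
  set g := Equiv.swap a a' * Equiv.swap b b' with hg
  have hab' : a' ≠ b' := by rintro rfl; exact hab.ne (ha'.1.symm.trans hb'.1)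
  have hba' : b' ≠ a := by rintro rfl; exact hab.ne hb'.1
  have hab'' : a' ≠ b := by rintro rfl; exact hab.ne ha'.1.symm
  have hga : g a = a' := by
    rw [hg, Equiv.Perm.mul_apply, Equiv.swap_apply_of_ne_of_ne hne hba'.symm,
      Equiv.swap_apply_left]
  have hgb : g b = b' := by
    rw [hg, Equiv.Perm.mul_apply, Equiv.swap_apply_left,
      Equiv.swap_apply_of_ne_of_ne hba' hab'.symm]
  have hμg : μ ∘ g = μ := by
    funext i
    rw [Function.comp_apply, hg, Equiv.Perm.mul_apply, blk_swap (blk := μ) ha'.2.symm,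
      blk_swap (blk := μ) hb'.2.symm]
  have hνeq : ν = μ ∘ Equiv.swap a' b' := by
    refine BlockAntitone.eq_of_comp hb hd hν (g * z) (fun i => ?_) ?_
    · rw [hg, Equiv.Perm.mul_apply, Equiv.Perm.mul_apply, blk_swap ha'.1.symm,
        blk_swap hb'.1.symm, hz]
    · have : g * Equiv.swap a b * z = Equiv.swap a' b' * (g * z) := by
        rw [Equiv.mul_swap_eq_swap_mul, hga, hgb, mul_assoc]
      rw [h]
      conv_lhs => rw [← hμg]
      exact congrArg (fun g : Equiv.Perm (Fin m) => μ ∘ g) this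
  refine Relation.ReflTransGen.single ⟨⟨a', b', ?_, ?_, ?_⟩, ?_, hν⟩
  · exact hb.reflect_lt (by rwa [ha'.1, hb'.1])
  · rw [ha'.2, hb'.2]
    exact hlt
  · rw [hνeq, act_swap]
  · rw [hνeq]
    exact horb _ hθ

end Blocks

theorem blockAntitone_iff {n : ℕ} {β : Type*} [LinearOrder β] {blk : Fin (n + 1) → β}
    (hb : Monotone blk) (μ : Fin (n + 1) → ℝ) :
    BlockAntitone blk μ ↔
      ∀ k : Fin n, blk k.castSucc = blk k.succ → μ k.succ ≤ μ k.castSucc := by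
  refine ⟨fun h k hk => h _ _ (Fin.castSucc_lt_succ).le hk, fun h i j hij => ?_⟩
  induction j using Fin.induction with
  | zero =>
    intro _
    rw [le_antisymm hij (Fin.zero_le i)]
  | succ k ih =>
    intro hk
    rcases hij.eq_or_lt with rfl | hlt
    · exact le_rfl
    · have hik : i ≤ k.castSucc := Fin.le_castSucc_iff.2 hlt
      have h1 : blk k.castSucc = blk k.succ :=
        le_antisymm (hb (Fin.castSucc_lt_succ).le) (hk ▸ hb hik)
      exact (h k h1).trans (ih hik (hk.trans h1.symm))

/-- Any set of simple reflections arises from a monotone labelling by blocks. -/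
theorem exists_monotone_blocks {n : ℕ} (I : Set (Fin n)) :
    ∃ blk : Fin (n + 1) → ℕ, Monotone blk ∧
      ∀ k : Fin n, blk k.castSucc = blk k.succ ↔ k ∈ I := by
  classical
  refine ⟨fun i => (Finset.univ.filter fun k : Fin n => k ∉ I ∧ k.castSucc < i).card, ?_, ?_⟩
  · intro i j hij
    apply Finset.card_le_card
    intro k hk
    simp only [Finset.mem_filter, Finset.mem_univ, true_and] at hk ⊢
    exact ⟨hk.1, hk.2.trans_le hij⟩
  · intro k
    constructor
    · intro h
      by_contra hk
      refine h.not_lt (Finset.card_lt_card ?_)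
      rw [Finset.ssubset_iff_of_subset]
      · exact ⟨k, by simp [hk]⟩
      · intro l hl
        simp only [Finset.mem_filter, Finset.mem_univ, true_and] at hl ⊢
        exact ⟨hl.1, hl.2.trans Fin.castSucc_lt_succ⟩
    · intro hk
      refine congrArg Finset.card (Finset.filter_congr fun l _ => ?_)
      refine and_congr_right fun hl => ⟨fun h => h.trans Fin.castSucc_lt_succ, fun h => ?_⟩
      rcases (Fin.le_castSucc_iff.2 h).eq_or_lt with h | h
      · exact absurd (Fin.castSucc_injective _ h ▸ hk) hl
      · exact h

/-- The one-line notation of `w`, negated. -/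
def negWord {m : ℕ} (w : Equiv.Perm (Fin m)) : Fin m → ℝ :=
  fun k => -((w k : ℕ) : ℝ)

theorem negWord_lt {m : ℕ} {w : Equiv.Perm (Fin m)} {i j : Fin m} :
    negWord w j < negWord w i ↔ w i < w j := by
  simp [negWord]

theorem negWord_le {m : ℕ} {w : Equiv.Perm (Fin m)} {i j : Fin m} :
    negWord w j ≤ negWord w i ↔ w i ≤ w j := by
  simp [negWord]

theorem negWord_injective {m : ℕ} : Function.Injective (negWord (m := m)) := by
  intro u v h
  ext k
  simpa [negWord] using congrFun h k

theorem negWord_eq_act {m : ℕ} (w : Equiv.Perm (Fin m)) :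
    negWord w = act w⁻¹ (negWord 1) := by
  funext k
  simp [negWord, act]

theorem bruhatLE_of_blockStep {m : ℕ} {β : Type*} {blk : Fin m → β}
    {x : Equiv.Perm (Fin m)} {κ : Fin m → ℝ}
    (h : Relation.ReflTransGen (BlockStep blk (negWord 1)) (negWord x) κ) :
    ∃ y, κ = negWord y ∧ bruhatLE x y := by
  induction h with
  | refl => exact ⟨x, rfl, Relation.ReflTransGen.refl⟩
  | tail _ hs ih =>
    obtain ⟨y, rfl, hxy⟩ := ih
    obtain ⟨⟨a, b, hab, hlt, rfl⟩, -⟩ := hs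
    rw [negWord_lt] at hlt
    refine ⟨y * Equiv.swap a b, by rw [act_swap]; rfl, hxy.tail ⟨⟨y a, y b, hlt.ne, ?_⟩, ?_⟩⟩
    · rw [Equiv.mul_swap_eq_swap_mul]
    · exact sLen_lt_sLen_mul_swap_s19 y hab hlt

section DoubleCosets

variable {n : ℕ} {θ : Fin (n + 1) → ℝ} {I : Set (Fin n)}

theorem blockAntitone_negWord_iff (hθ : Antitone θ) (w : Equiv.Perm (Fin (n + 1))) :
    BlockAntitone (fun i => -θ i) (negWord w) ↔ {k : Fin n | θ k.castSucc = θ k.succ} ⊆ (Des w)ᶜ := by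
  rw [blockAntitone_iff hθ.neg]
  simp [Set.subset_def, Des, negWord_le]

theorem mem_Xminus_iff (hθ : Antitone θ) (w : Equiv.Perm (Fin (n + 1))) :
    w ∈ Xminus I {k : Fin n | θ k.castSucc = θ k.succ} ↔
      BlockAntitone (fun i => -θ i) (negWord w) ∧ ∀ a ∈ I, act w θ a.succ ≤ act w θ a.castSucc := by
  rw [blockAntitone_negWord_iff hθ, Xminus, Set.mem_ofPred_eq, and_comm]
  refine and_congr_right fun hJ => ?_
  rw [← blockAntitone_negWord_iff hθ] at hJ
  constructor
  · intro h a ha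
    exact hθ (not_lt.1 (h ha))
  · intro h a ha hd
    have hd' : w⁻¹ a.succ < w⁻¹ a.castSucc := hd
    have heq : θ (w⁻¹ a.succ) = θ (w⁻¹ a.castSucc) := le_antisymm (h a ha) (hθ hd'.le)
    have := hJ _ _ hd'.le (neg_inj.2 heq)
    rw [negWord_le] at this
    simp only [perm_apply_inv_apply] at this
    exact this.not_gt Fin.castSucc_lt_succ

theorem eq_of_act_eq (hθ : Antitone θ) {u v : Equiv.Perm (Fin (n + 1))}
    (hu : BlockAntitone (fun i => -θ i) (negWord u)) (hv : BlockAntitone (fun i => -θ i) (negWord v))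
    (h : act u θ = act v θ) : u = v := by
  refine (negWord_injective (BlockAntitone.eq_of_comp hθ.neg hu hv (u⁻¹ * v) ?_ ?_)).symm
  · intro i
    have := congrFun h (v i)
    simpa [act] using this
  · funext i
    simp [negWord]

theorem exists_blockAntitone_act_eq (hθ : Antitone θ) (w : Equiv.Perm (Fin (n + 1))) :
    ∃ v, BlockAntitone (fun i => -θ i) (negWord v) ∧ act v θ = act w θ := by
  obtain ⟨z, hz, hd⟩ := exists_blockAntitone_comp hθ.neg (negWord w)
  refine ⟨w * z, hd, ?_⟩
  funext k
  have := blk_inv (blk := fun i => -θ i) hz (w⁻¹ k)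
  simpa [act] using this

theorem reflTransGen_of_bruhatLE (hθ : Antitone θ) {blk : Fin (n + 1) → ℕ} (hb : Monotone blk)
    {u v : Equiv.Perm (Fin (n + 1))} (huv : bruhatLE u v) (hu : BlockAntitone blk (act u θ))
    {ν : Fin (n + 1) → ℝ} (hν : BlockAntitone blk ν) (z : Equiv.Perm (Fin (n + 1)))
    (hz : ∀ i, blk (z i) = blk i) (h : ν = act v θ ∘ z) :
    Relation.ReflTransGen (BlockStep blk θ) (act u θ) ν := by
  induction huv generalizing ν z with
  | refl => rw [BlockAntitone.eq_of_comp hb hu hν z hz h]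
  | @tail x y _ hs ih =>
    obtain ⟨⟨a, b, hne, rfl⟩, hlen⟩ := hs
    wlog hab : a < b generalizing a b
    · rw [Equiv.swap_comm] at h hlen
      exact this b a hne.symm h hlen (lt_of_le_of_ne (not_lt.1 hab) hne.symm)
    have hinv := inv_lt_inv_of_sLen_lt x hab hlen
    have hact : act (Equiv.swap a b * x) θ = act x θ ∘ Equiv.swap a b := by
      funext k
      simp [act]
    rw [hact] at h
    rcases (hθ hinv.le).eq_or_lt with heq | hlt
    · refine ih hν z hz ?_
      rw [h]
      congr 1
      funext i
      exact blk_swap (blk := act x θ) heq.symm i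
    · obtain ⟨z₁, hz₁, hd⟩ := exists_blockAntitone_comp hb (act x θ)
      refine (ih hd z₁ hz₁ rfl).trans ?_
      refine reflTransGen_blockStep hb (a := z₁⁻¹ a) (b := z₁⁻¹ b) ⟨z₁⁻¹ * x, ?_⟩ hd hν ?_ ?_
        (z₁⁻¹ * z) ?_ ?_
      · funext k
        simp [act]
      · rw [blk_inv hz₁, blk_inv hz₁]
        exact hb hab.le
      · simpa [act] using hlt
      · intro i
        rw [Equiv.Perm.mul_apply, blk_inv hz₁, hz]
      · have : Equiv.swap a b * z = z₁ * Equiv.swap (z₁⁻¹ a) (z₁⁻¹ b) * (z₁⁻¹ * z) := by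
          rw [Equiv.mul_swap_eq_swap_mul, perm_apply_inv_apply, perm_apply_inv_apply]
          group
        rw [h]
        exact congrArg (fun g : Equiv.Perm (Fin (n + 1)) => act x θ ∘ g) this

theorem bruhatLE_of_act_eq_swap (hθ : Antitone θ) {x v : Equiv.Perm (Fin (n + 1))}
    (hx : BlockAntitone (fun i => -θ i) (negWord x)) (hv : BlockAntitone (fun i => -θ i) (negWord v))
    {a b : Fin (n + 1)} (hab : a < b) (hlt : act x θ b < act x θ a)
    (h : act v θ = act (Equiv.swap a b) (act x θ)) : bruhatLE x v := by
  have hstep : Relation.ReflTransGen (BlockStep (fun i => -θ i) (negWord 1)) (negWord x) (negWord v) := by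
    refine reflTransGen_blockStep hθ.neg (a := x⁻¹ a) (b := x⁻¹ b) ⟨x⁻¹, negWord_eq_act x⟩ hx hv
      ?_ ?_ (x⁻¹ * Equiv.swap a b * v) ?_ ?_
    · exact neg_le_neg hlt.le
    · rw [negWord_lt]
      simpa using hab
    · intro i
      have := congrFun h (v i)
      simpa [act] using this.symm
    · have : v = x * (Equiv.swap (x⁻¹ a) (x⁻¹ b) * (x⁻¹ * Equiv.swap a b * v)) := by
        rw [← mul_assoc, Equiv.mul_swap_eq_swap_mul, perm_apply_inv_apply,
          perm_apply_inv_apply]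
        simp [mul_assoc]
      conv_lhs => rw [this]
      rfl
  obtain ⟨y, hy, hxy⟩ := bruhatLE_of_blockStep hstep
  rwa [negWord_injective hy]

theorem bruhatLE_of_reflTransGen (hθ : Antitone θ) {β : Type*} {blk : Fin (n + 1) → β}
    {u v : Equiv.Perm (Fin (n + 1))}
    (hu : BlockAntitone (fun i => -θ i) (negWord u)) (hv : BlockAntitone (fun i => -θ i) (negWord v))
    (h : Relation.ReflTransGen (BlockStep blk θ) (act u θ) (act v θ)) : bruhatLE u v := by
  generalize hκ : act v θ = κ at h
  induction h generalizing v with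
  | refl => rw [eq_of_act_eq hθ hu hv hκ.symm]; exact Relation.ReflTransGen.refl
  | @tail κ₁ κ₂ hr hs ih =>
    have horb : ∃ w, κ₁ = act w θ := by
      rcases Relation.ReflTransGen.cases_tail hr with h | ⟨_, _, h⟩
      exacts [⟨u, h⟩, h.2.1]
    obtain ⟨w, rfl⟩ := horb
    obtain ⟨x, hx, hxw⟩ := exists_blockAntitone_act_eq hθ w
    obtain ⟨⟨a, b, hab, hlt, rfl⟩, -⟩ := hs
    rw [← hxw] at hlt hκ
    exact (ih hx hxw).trans (bruhatLE_of_act_eq_swap hθ hx hv hab hlt hκ)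

end DoubleCosets

/-- Let `θ` be dominant (`θ_1 ≥ ⋯ ≥ θ_{n+1}`), `J = {s_k : θ_k = θ_{k+1}}`
(so `W_J` is the stabilizer of `θ`), and `I ⊆ R`.  Let
`(Wθ)_I = {μ ∈ Wθ : μ_a ≥ μ_{a+1} for all s_a ∈ I}`, ordered by the transitive
closure of `μ < t·μ` for transpositions `t = (a b)`, `a < b`, with `μ_a > μ_b`
and `t·μ ∈ (Wθ)_I`.  Then `w ↦ w·θ` is an order isomorphism from
`(X⁻_{I,J}, Bruhat)` onto `((Wθ)_I, ≤_B)`. -/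
theorem stmt_19 (n : ℕ) (hn : 1 ≤ n) (θ : Fin (n + 1) → ℝ)
    (hθ : ∀ k : Fin n, θ k.succ ≤ θ k.castSucc) (I : Set (Fin n)) :
    Set.BijOn (fun w : Equiv.Perm (Fin (n + 1)) => act w θ)
      (Xminus I {k : Fin n | θ k.castSucc = θ k.succ})
      {μ : Fin (n + 1) → ℝ | (∃ w : Equiv.Perm (Fin (n + 1)), μ = act w θ) ∧
        ∀ a : Fin n, a ∈ I → μ a.succ ≤ μ a.castSucc} ∧
    ∀ u ∈ Xminus I {k : Fin n | θ k.castSucc = θ k.succ},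
      ∀ v ∈ Xminus I {k : Fin n | θ k.castSucc = θ k.succ},
        (bruhatLE u v ↔
          Relation.ReflTransGen
            (fun μ ν : Fin (n + 1) → ℝ =>
              (∃ a b : Fin (n + 1), a < b ∧ μ b < μ a ∧ ν = act (Equiv.swap a b) μ) ∧
              ((∃ w : Equiv.Perm (Fin (n + 1)), ν = act w θ) ∧
                ∀ a : Fin n, a ∈ I → ν a.succ ≤ ν a.castSucc))
            (act u θ) (act v θ)) := by
  have hanti : Antitone θ := Fin.antitone_iff_succ_le.2 hθ
  obtain ⟨blk, hb, hblk⟩ := exists_monotone_blocks I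
  have hdom : ∀ μ : Fin (n + 1) → ℝ,
      (∀ a : Fin n, a ∈ I → μ a.succ ≤ μ a.castSucc) ↔ BlockAntitone blk μ := by
    intro μ
    simp only [blockAntitone_iff hb, hblk]
  refine ⟨⟨?_, ?_, ?_⟩, ?_⟩
  · intro w hw
    exact ⟨⟨w, rfl⟩, ((mem_Xminus_iff hanti w).1 hw).2⟩
  · intro u hu v hv h
    exact eq_of_act_eq hanti ((mem_Xminus_iff hanti u).1 hu).1 ((mem_Xminus_iff hanti v).1 hv).1 h
  · rintro _ ⟨⟨w, rfl⟩, hI⟩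
    obtain ⟨v, hv, hvw⟩ := exists_blockAntitone_act_eq hanti w
    exact ⟨v, (mem_Xminus_iff hanti v).2 ⟨hv, hvw ▸ hI⟩, hvw⟩
  · intro u hu v hv
    rw [mem_Xminus_iff hanti, hdom] at hu hv
    simp only [hdom]
    exact ⟨fun h => reflTransGen_of_bruhatLE hanti hb h hu.2 hv.2 1 (fun _ => rfl) rfl,
      fun h => bruhatLE_of_reflTransGen hanti hu.1 hv.1 h⟩
end
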